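/- arXiv:1809.10076 — 3 statements merged into one kernel-verified Lean document; each statement's English description precedes it below -/
import Mathlib

section
/- Let m ≤ n and let H ∈ Matrix (Fin m) (Fin n) ℂ admit an SVD factorization H = U·Λ̃·Wᴴ with unitary U, W and singular values λ : Fin m → ℝ. Then for every η > 0, (Hᴴ·H + η·1)⁻¹·Hᴴ = W·Ξ̃·Uᴴ, where Ξ̃ ∈ Matrix (Fin n) (Fin m) ℂ is defined by Ξ̃_{j,i} = λ_i/(λ_i² + η) if (j : ℕ) = (i : ℕ) and 0 otherwise. (The regularized inverse of a matrix expressed through its SVD, used to construct the optimal precoder of Theorem 5.) -/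
open Matrix

open scoped ComplexOrder in
theorem regInv_det {m n : ℕ} (H : Matrix (Fin m) (Fin n) ℂ) (η : ℝ) (hη : 0 < η) :
    IsUnit (Hᴴ * H + (η : ℂ) • (1 : Matrix (Fin n) (Fin n) ℂ)).det := by
  have hpd : (Hᴴ * H + (η : ℂ) • (1 : Matrix (Fin n) (Fin n) ℂ)).PosDef := by
    refine Matrix.PosDef.posSemidef_add (Matrix.posSemidef_conjTranspose_mul_self H) ?_
    exact Matrix.PosDef.one.smul (by exact_mod_cast hη)
  exact (Matrix.isUnit_iff_isUnit_det _).mp hpd.isUnit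

/-- The regularized inverse of a matrix expressed through its SVD: if `H = U Λ̃ Wᴴ`
with `U`, `W` unitary and singular values `lam`, then for every `η > 0`,
`(Hᴴ H + η I)⁻¹ Hᴴ = W Ξ̃ Uᴴ` where `Ξ̃` has entries `lam i / (lam i² + η)` on the
"diagonal" and zeros elsewhere. -/
theorem regularized_inverse_svd {m n : ℕ} (hmn : m ≤ n)
    (H : Matrix (Fin m) (Fin n) ℂ)
    (U : Matrix (Fin m) (Fin m) ℂ) (W : Matrix (Fin n) (Fin n) ℂ)
    (hU : U ∈ Matrix.unitaryGroup (Fin m) ℂ)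
    (hW : W ∈ Matrix.unitaryGroup (Fin n) ℂ)
    (lam : Fin m → ℝ)
    (hH : H = U * (Matrix.of fun (i : Fin m) (j : Fin n) =>
      if (j : ℕ) = (i : ℕ) then ((lam i : ℝ) : ℂ) else 0) * Wᴴ)
    (η : ℝ) (hη : 0 < η) :
    (Hᴴ * H + (η : ℂ) • (1 : Matrix (Fin n) (Fin n) ℂ))⁻¹ * Hᴴ
      = W * (Matrix.of fun (j : Fin n) (i : Fin m) =>
          if (j : ℕ) = (i : ℕ) then ((lam i / (lam i ^ 2 + η) : ℝ) : ℂ) else 0) * Uᴴ := by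
  set L : Matrix (Fin m) (Fin n) ℂ := Matrix.of fun (i : Fin m) (j : Fin n) =>
      if (j : ℕ) = (i : ℕ) then ((lam i : ℝ) : ℂ) else 0 with hL
  set X : Matrix (Fin n) (Fin m) ℂ := Matrix.of fun (j : Fin n) (i : Fin m) =>
          if (j : ℕ) = (i : ℕ) then ((lam i / (lam i ^ 2 + η) : ℝ) : ℂ) else 0 with hX
  have hUU : Uᴴ * U = 1 := Matrix.mem_unitaryGroup_iff'.mp hU
  have hWW : Wᴴ * W = 1 := Matrix.mem_unitaryGroup_iff'.mp hW
  have hdet := regInv_det H η hη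
  have hLX : L * X = Matrix.diagonal fun i => ((lam i * (lam i / (lam i ^ 2 + η)) : ℝ) : ℂ) := by
    ext i k
    rw [Matrix.mul_apply, Finset.sum_eq_single (Fin.castLE hmn i)]
    · by_cases h : i = k
      · subst h
        simp [hL, hX]
      · have h2 : (i : ℕ) ≠ k := fun e => h (Fin.ext e)
        simp [hL, hX, h, h2]
    · intro j _ hj
      have h2 : (j : ℕ) ≠ i := fun e => hj (Fin.ext e)
      simp [hL, h2]
    · simp
  have key : Lᴴ * (L * X) + (η : ℂ) • X = Lᴴ := by
    rw [hLX]
    ext j i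
    have hne : (lam i ^ 2 + η) ≠ 0 := by positivity
    have hne' : ((lam i : ℂ) ^ 2 + η) ≠ 0 := by exact_mod_cast hne
    rw [Matrix.add_apply, Matrix.mul_diagonal]
    by_cases h : (j : ℕ) = i
    · simp [hL, hX, h]
      field_simp
    · simp [hL, hX, h]
  have hHH : Hᴴ = W * Lᴴ * Uᴴ := by
    rw [hH]; simp [Matrix.conjTranspose_mul, Matrix.mul_assoc]
  have main : (Hᴴ * H + (η : ℂ) • (1 : Matrix (Fin n) (Fin n) ℂ)) * (W * X * Uᴴ) = Hᴴ := by
    calc _ = W * Lᴴ * (Uᴴ * U) * L * (Wᴴ * W) * X * Uᴴ + (η : ℂ) • (W * X * Uᴴ) := by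
          rw [hHH, hH, Matrix.add_mul]
          simp only [Matrix.mul_assoc, Matrix.smul_mul, Matrix.one_mul]
      _ = W * (Lᴴ * (L * X) + (η : ℂ) • X) * Uᴴ := by
          rw [hUU, hWW]
          simp only [Matrix.mul_assoc, Matrix.mul_one, Matrix.one_mul, Matrix.mul_add,
            Matrix.add_mul, Matrix.smul_mul, Matrix.mul_smul]
      _ = Hᴴ := by rw [key, hHH]
  rw [← Matrix.nonsing_inv_mul_cancel_left _ (W * X * Uᴴ) hdet, main]
end

section
/- Let u, u', v, v' ∈ ℝ and suppose that exp(I·u) ≠ exp(I·u') or exp(I·v) ≠ exp(I·v'). Then the normalized inner product of the corresponding 2D array response vectors tends to zero as the array dimensions grow: (1/(M₁·M₂))·⟨e_{M₁,M₂}(u,v), e_{M₁,M₂}(u',v')⟩ = (1/(M₁·M₂))·(Σ_{k=0}^{M₁−1} exp(I·k·(u'−u)))·(Σ_{l=0}^{M₂−1} exp(I·l·(v'−v))) tends to 0 along the product filter atTop ×ˢ atTop in (M₁, M₂). (Deterministic core of the paper's Lemma 3: normalized array response vectors of a 2D planar array with distinct spatial frequencies become orthogonal asymptotically as the number of antennas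 grows large.) -/
open Filter Complex

lemma arr_bound (x : ℝ) (n : ℕ) :
    ‖(1 / (n : ℂ)) * ∑ k ∈ Finset.range n, Complex.exp (Complex.I * (k : ℂ) * (x : ℂ))‖ ≤ 1 := by
  have h1 : ‖∑ k ∈ Finset.range n, Complex.exp (Complex.I * (k : ℂ) * (x : ℂ))‖ ≤ (n : ℝ) := by
    refine (norm_sum_le _ _).trans ?_
    have : ∀ k ∈ Finset.range n, ‖Complex.exp (Complex.I * (k : ℂ) * (x : ℂ))‖ = 1 := by
      intro k _
      have e : Complex.I * (k : ℂ) * (x : ℂ) = ((k * x : ℝ) : ℂ) * Complex.I := by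
        push_cast; ring
      rw [e, Complex.norm_exp_ofReal_mul_I]
    rw [Finset.sum_congr rfl this]
    simp
  rw [norm_mul, norm_div, norm_one, Complex.norm_natCast, one_div, inv_mul_eq_div]
  exact div_le_one_of_le₀ h1 (Nat.cast_nonneg n)

lemma arr_tendsto (a b : ℝ)
    (h : Complex.exp (Complex.I * (a : ℂ)) ≠ Complex.exp (Complex.I * (b : ℂ))) :
    Tendsto (fun n : ℕ => (1 / (n : ℂ)) *
      ∑ k ∈ Finset.range n, Complex.exp (Complex.I * (k : ℂ) * ((b - a : ℝ) : ℂ)))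
      atTop (nhds 0) := by
  set z : ℂ := Complex.exp (((b - a : ℝ) : ℂ) * Complex.I) with hz
  have hn : ‖z‖ = 1 := Complex.norm_exp_ofReal_mul_I _
  have hz1 : z ≠ 1 := by
    intro hh
    apply h
    have e : Complex.I * (b : ℂ) = ((b - a : ℝ) : ℂ) * Complex.I + Complex.I * (a : ℂ) := by
      push_cast; ring
    rw [e, Complex.exp_add, ← hz, hh, one_mul]
  have hpos : 0 < ‖z - 1‖ := norm_pos_iff.2 (sub_ne_zero.2 hz1)
  have hlim : Tendsto (fun n : ℕ => (2 / ‖z - 1‖) / (n : ℝ)) atTop (nhds 0) :=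
    tendsto_const_div_atTop_nhds_zero_nat _
  refine squeeze_zero_norm (fun n => ?_) hlim
  have hs : ∑ k ∈ Finset.range n, Complex.exp (Complex.I * (k : ℂ) * ((b - a : ℝ) : ℂ))
      = (z ^ n - 1) / (z - 1) := by
    rw [← geom_sum_eq hz1]
    refine Finset.sum_congr rfl fun k _ => ?_
    rw [hz, ← Complex.exp_nat_mul]
    congr 1
    ring
  rw [hs, norm_mul, norm_div, norm_one, Complex.norm_natCast, one_div, inv_mul_eq_div, norm_div]
  have h2 : ‖z ^ n - 1‖ ≤ 2 := by
    refine (norm_sub_le _ _).trans ?_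
    rw [norm_pow, hn]
    norm_num
  gcongr

/-- Deterministic core of the paper's Lemma 3: if the spatial-frequency pairs differ
(mod 2π) in at least one coordinate, the normalized inner product of the 2D array
response vectors, `(1/(M₁M₂)) (Σ_{k<M₁} e^{ik(u'−u)}) (Σ_{l<M₂} e^{il(v'−v)})`, tends to
`0` as the array dimensions `(M₁, M₂)` grow along `atTop ×ˢ atTop`. -/
theorem array_response_asymptotic_orthogonality (u u' v v' : ℝ)
    (h : Complex.exp (Complex.I * (u : ℂ)) ≠ Complex.exp (Complex.I * (u' : ℂ)) ∨
         Complex.exp (Complex.I * (v : ℂ)) ≠ Complex.exp (Complex.I * (v' : ℂ))) :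
    Tendsto (fun p : ℕ × ℕ =>
        (1 / ((p.1 : ℂ) * (p.2 : ℂ))) *
          ((∑ k ∈ Finset.range p.1, Complex.exp (Complex.I * (k : ℂ) * ((u' - u : ℝ) : ℂ))) *
           (∑ l ∈ Finset.range p.2, Complex.exp (Complex.I * (l : ℂ) * ((v' - v : ℝ) : ℂ)))))
      (atTop ×ˢ atTop) (nhds 0) := by
  have key : ∀ p : ℕ × ℕ, (1 / ((p.1 : ℂ) * (p.2 : ℂ))) *
          ((∑ k ∈ Finset.range p.1, Complex.exp (Complex.I * (k : ℂ) * ((u' - u : ℝ) : ℂ))) *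
           (∑ l ∈ Finset.range p.2, Complex.exp (Complex.I * (l : ℂ) * ((v' - v : ℝ) : ℂ))))
      = ((1 / (p.1 : ℂ)) *
          ∑ k ∈ Finset.range p.1, Complex.exp (Complex.I * (k : ℂ) * ((u' - u : ℝ) : ℂ))) *
        ((1 / (p.2 : ℂ)) *
          ∑ l ∈ Finset.range p.2, Complex.exp (Complex.I * (l : ℂ) * ((v' - v : ℝ) : ℂ))) := by
    intro p
    rw [one_div, mul_inv, one_div, one_div]
    ring
  rcases h with h | h
  · refine squeeze_zero_norm (fun p => ?_) ((arr_tendsto u u' h).norm.comp tendsto_fst |>.trans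
      (by rw [norm_zero]))
    rw [key p, norm_mul]
    exact mul_le_of_le_one_right (norm_nonneg _) (arr_bound _ _)
  · refine squeeze_zero_norm (fun p => ?_) ((arr_tendsto v v' h).norm.comp tendsto_snd |>.trans
      (by rw [norm_zero]))
    rw [key p, norm_mul]
    exact mul_le_of_le_one_left (norm_nonneg _) (arr_bound _ _)
end

section
/- Let (Ω, ℱ, ℙ) be a probability space and let θ, θ' : Ω → ℝ be independent random variables whose distributions (pushforward laws) are atomless. Let v, v' : Ω → ℝ be arbitrary random variables, and set u = π·cos θ and u' = π·cos θ' (the elevation spatial frequencies for half-wavelength antenna spacing). Then for ℙ-almost every ω, (1/(M₁·M₂))·⟨e_{M₁,M₂}(u(ω),v(ω)), e_{M₁,M₂}(u'(ω),v'(ω))⟩ → 0 as (M₁,M₂) → ∞ along the product filter atTop ×ˢ atTop. (The paper's Lemma 3: if the elevation angles are drawn independently from continuous distributions, the normalized array response vectors become orthogonal asymptotically as the number of base-station antennas grows large.) -/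
open Filter MeasureTheory ProbabilityTheory

/-- The Hermitian inner product `⟨e_{M₁,M₂}(u,v), e_{M₁,M₂}(u',v')⟩` of two 2D array
response vectors, whose entries are `exp(I(k·u + l·v))` for `0 ≤ k < M₁`, `0 ≤ l < M₂`. -/
noncomputable def arrayInner (M₁ M₂ : ℕ) (u v u' v' : ℝ) : ℂ :=
  ∑ k ∈ Finset.range M₁, ∑ l ∈ Finset.range M₂,
    (starRingEnd ℂ) (Complex.exp (Complex.I * ((k : ℂ) * (u : ℂ) + (l : ℂ) * (v : ℂ)))) *
      Complex.exp (Complex.I * ((k : ℂ) * (u' : ℂ) + (l : ℂ) * (v' : ℂ)))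

lemma aux_countable (x : ℝ) : {y : ℝ | Complex.exp (Complex.I *
    ((Real.pi * Real.cos y : ℝ) - (Real.pi * Real.cos x : ℝ))) = 1}.Countable := by
  have hc : ∀ c : ℝ, {y : ℝ | Real.cos y = c}.Countable := by
    intro c
    by_cases h : ∃ y0, Real.cos y0 = c
    · obtain ⟨y0, rfl⟩ := h
      refine ((Set.countable_range (fun k : ℤ => 2 * k * Real.pi + y0)).union
        (Set.countable_range (fun k : ℤ => 2 * k * Real.pi - y0))).mono ?_
      intro y hy
      obtain ⟨k, hk | hk⟩ := Real.cos_eq_cos_iff.1 (Eq.symm hy)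
      · exact Or.inl ⟨k, hk.symm⟩
      · exact Or.inr ⟨k, hk.symm⟩
    · have : {y : ℝ | Real.cos y = c} = ∅ := by
        ext y
        simp only [Set.mem_ofPred_eq, Set.mem_empty_iff_false, iff_false]
        exact fun hy => h ⟨y, hy⟩
      rw [this]
      exact Set.countable_empty
  refine (Set.countable_iUnion (fun n : ℤ => hc (Real.cos x + 2 * n))).mono ?_
  intro y hy
  obtain ⟨n, hn⟩ := Complex.exp_eq_one_iff.1 hy
  refine Set.mem_iUnion.2 ⟨n, ?_⟩
  have h := congrArg Complex.im hn
  simp [-Complex.ofReal_mul, -Complex.ofReal_cos] at h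
  have hp := Real.pi_pos
  have : Real.pi * Real.cos y = Real.pi * (Real.cos x + 2 * n) := by linarith
  exact mul_left_cancel₀ hp.ne' this

lemma aux_factor (M₁ M₂ : ℕ) (u v u' v' : ℝ) : arrayInner M₁ M₂ u v u' v' =
    (∑ k ∈ Finset.range M₁, Complex.exp (Complex.I * (u' - u)) ^ k) *
    (∑ l ∈ Finset.range M₂, Complex.exp (Complex.I * (v' - v)) ^ l) := by
  unfold arrayInner
  rw [Finset.sum_mul_sum]
  refine Finset.sum_congr rfl fun k _ => Finset.sum_congr rfl fun l _ => ?_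
  rw [← Complex.exp_conj, ← Complex.exp_add, ← Complex.exp_nat_mul, ← Complex.exp_nat_mul,
    ← Complex.exp_add]
  congr 1
  simp only [map_mul, map_add, Complex.conj_I, Complex.conj_ofReal, Complex.conj_natCast]
  ring

lemma aux_norm (a b : ℝ) : ‖Complex.exp (Complex.I * (a - b))‖ = 1 := by
  rw [← Complex.ofReal_sub, mul_comm]
  exact Complex.norm_exp_ofReal_mul_I _

lemma aux_tendsto (u v u' v' : ℝ) (h : Complex.exp (Complex.I * (u' - u)) ≠ 1) :
    Tendsto (fun p : ℕ × ℕ => (1 / ((p.1 : ℂ) * (p.2 : ℂ))) * arrayInner p.1 p.2 u v u' v')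
      (atTop ×ˢ atTop) (nhds 0) := by
  set z := Complex.exp (Complex.I * (u' - u)) with hz
  have hzn : ‖z‖ = 1 := aux_norm _ _
  have hpos : 0 < ‖z - 1‖ := norm_pos_iff.2 (sub_ne_zero.2 h)
  have hlim : Tendsto (fun p : ℕ × ℕ => (2 / ‖z - 1‖) / (p.1 : ℝ)) (atTop ×ˢ atTop)
      (nhds 0) :=
    (tendsto_const_div_atTop_nhds_zero_nat _).comp tendsto_fst
  refine squeeze_zero_norm (fun p => ?_) hlim
  obtain ⟨m, n⟩ := p
  rw [aux_factor, ← hz]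
  have h1 : ‖∑ k ∈ Finset.range m, z ^ k‖ ≤ 2 / ‖z - 1‖ := by
    rw [geom_sum_eq h, norm_div]
    gcongr
    calc ‖z ^ m - 1‖ ≤ ‖z ^ m‖ + ‖(1 : ℂ)‖ := norm_sub_le _ _
      _ = 2 := by rw [norm_pow, hzn]; norm_num
  have h2 : ‖∑ l ∈ Finset.range n, Complex.exp (Complex.I * (v' - v)) ^ l‖ ≤ n := by
    refine (norm_sum_le _ _).trans ?_
    simp [norm_pow, aux_norm]
  rw [norm_mul, norm_mul, norm_div, norm_mul, norm_one, Complex.norm_natCast,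
    Complex.norm_natCast]
  calc _ ≤ 1 / ((m : ℝ) * n) * ((2 / ‖z - 1‖) * n) := by gcongr
    _ = (2 / ‖z - 1‖) / m * ((n : ℝ) / n) := by simp only [div_eq_mul_inv, mul_inv]; ring
    _ ≤ (2 / ‖z - 1‖) / m * 1 := by
        gcongr
        exact div_self_le_one _
    _ = _ := mul_one _

/-- The paper's Lemma 3: if the elevation angles `θ, θ'` are independent with atomless
distributions, then with `u = π cos θ`, `u' = π cos θ'` the elevation spatial frequencies
(half-wavelength spacing), for almost every sample the normalized inner product of the
corresponding 2D array response vectors tends to `0` as the array grows. -/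
theorem array_response_orthogonal_ae {Ω : Type*} [MeasurableSpace Ω]
    (μpr : Measure Ω) [IsProbabilityMeasure μpr]
    (θ θ' : Ω → ℝ) (hθm : Measurable θ) (hθ'm : Measurable θ')
    (hind : IndepFun θ θ' μpr)
    (hθa : ∀ x : ℝ, μpr.map θ {x} = 0) (hθ'a : ∀ x : ℝ, μpr.map θ' {x} = 0)
    (v v' : Ω → ℝ) :
    ∀ᵐ ω ∂μpr, Tendsto (fun p : ℕ × ℕ =>
        (1 / ((p.1 : ℂ) * (p.2 : ℂ))) *
          arrayInner p.1 p.2 (Real.pi * Real.cos (θ ω)) (v ω)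
            (Real.pi * Real.cos (θ' ω)) (v' ω))
      (atTop ×ˢ atTop) (nhds 0) := by
  have hm : MeasurableSet {q : ℝ × ℝ | Complex.exp (Complex.I *
      ((Real.pi * Real.cos q.2 : ℝ) - (Real.pi * Real.cos q.1 : ℝ))) = 1} :=
    (isClosed_eq (by fun_prop) continuous_const).measurableSet
  have : NullSingletonClass (μpr.map θ') := ⟨hθ'a⟩
  have hprod := (indepFun_iff_map_prod_eq_prod_map_map hθm.aemeasurable hθ'm.aemeasurable).1 hind
  have hfin : IsProbabilityMeasure (μpr.map θ') := Measure.isProbabilityMeasure_map hθ'm.aemeasurable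
  have h0 : (μpr.map (fun ω => (θ ω, θ' ω))) {q : ℝ × ℝ | Complex.exp (Complex.I *
      ((Real.pi * Real.cos q.2 : ℝ) - (Real.pi * Real.cos q.1 : ℝ))) = 1} = 0 := by
    rw [hprod, Measure.measure_prod_null hm]
    exact Filter.Eventually.of_forall fun x => (aux_countable x).measure_zero _
  rw [Measure.map_apply (hθm.prodMk hθ'm) hm] at h0
  have h1 := measure_eq_zero_iff_ae_notMem.1 h0
  filter_upwards [h1] with ω hω
  exact aux_tendsto _ _ _ _ hω
end
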